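/- arXiv:0904.1406 — 7 statements merged into one kernel-verified Lean document; each statement's English description precedes it below -/
import Mathlib

section
/- A smooth vector field X on ℝ^{2n+1} preserves the contact distribution ker η^R — that is, for every smooth vector field Y with η^R_p(Y(p)) = 0 for all p one has η^R_p([X,Y](p)) = 0 for all p — if and only if X has the contact Hamiltonian form X = (F − Σ_i y_i ∂F/∂y_i)∂_z − Σ_i (∂F/∂y_i)∂_{x_i} + Σ_i (y_i ∂F/∂z + ∂F/∂x_i)∂_{y_i}, where F is the smooth function F(p) = η^R_p(X(p)). -/
/-- The underlying space of the Heisenberg group `ℍ^{2n+1}`. -/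
abbrev Heis (n : ℕ) : Type := (Fin n → ℝ) × (Fin n → ℝ) × ℝ

/-- The Lie bracket of vector fields `[V,W](p) = DW(p)(V(p)) − DV(p)(W(p))`. -/
noncomputable def lieVF {n : ℕ} (V W : Heis n → Heis n) : Heis n → Heis n :=
  fun p => fderiv ℝ W p (V p) - fderiv ℝ V p (W p)

/-- The standard (right invariant) contact form `η^R_p(v) = v_z − Σ_i y_i v_{x_i}`. -/
def etaR {n : ℕ} (p v : Heis n) : ℝ := v.2.2 - ∑ i, p.2.1 i * v.1 i

/-- The contact Hamiltonian vector field associated to a smooth function `F`: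
`X_F = (F − Σ_i y_i ∂F/∂y_i)∂_z − Σ_i (∂F/∂y_i)∂_{x_i} + Σ_i (y_i ∂F/∂z + ∂F/∂x_i)∂_{y_i}`. -/
noncomputable def hamVF {n : ℕ} (F : Heis n → ℝ) : Heis n → Heis n := fun p =>
  (fun i => -(fderiv ℝ F p (0, Pi.single i 1, 0)),
   fun i => p.2.1 i * fderiv ℝ F p (0, 0, 1) + fderiv ℝ F p (Pi.single i 1, 0, 0),
   F p - ∑ i, p.2.1 i * fderiv ℝ F p (0, Pi.single i 1, 0))

/-- Product rule for the contraction of a vector field with `η^R`. -/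
lemma fderiv_etaR {n : ℕ} {Y : Heis n → Heis n} {p : Heis n} (hY : DifferentiableAt ℝ Y p)
    (v : Heis n) :
    fderiv ℝ (fun q => etaR q (Y q)) p v =
      etaR p (fderiv ℝ Y p v) - ∑ i, v.2.1 i * (Y p).1 i := by
  have hx (i : Fin n) := hasFDerivAt_pi'.1 hY.hasFDerivAt.fst i
  have hy (i : Fin n) := hasFDerivAt_pi'.1 (hasFDerivAt_id (𝕜 := ℝ) p).snd.fst i
  have h := hY.hasFDerivAt.snd.snd.sub
    (HasFDerivAt.fun_sum (u := Finset.univ) fun i _ => (hy i).mul (hx i))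
  have h' : HasFDerivAt (fun q => etaR q (Y q)) _ p := h
  rw [h'.fderiv]
  simp [etaR, Finset.sum_add_distrib, mul_comm, sub_sub]

/-- The contraction of `[X,Y]` with `η^R` when `Y` is tangent to the contact distribution. -/
lemma etaR_lieVF {n : ℕ} {X Y : Heis n → Heis n} (hX : Differentiable ℝ X)
    (hY : Differentiable ℝ Y) (hYker : ∀ p, etaR p (Y p) = 0) (p : Heis n) :
    etaR p (lieVF X Y p) = ∑ i, (X p).2.1 i * (Y p).1 i - ∑ i, (Y p).2.1 i * (X p).1 i
      - fderiv ℝ (fun q => etaR q (X q)) p (Y p) := by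
  have h1 := fderiv_etaR (hY p) (X p)
  have h2 := fderiv_etaR (hX p) (Y p)
  simp only [hYker, fderiv_fun_const, Pi.zero_apply, zero_apply] at h1
  have hsub (a b : Heis n) : etaR p (a - b) = etaR p a - etaR p b := by
    simp only [etaR, Prod.fst_sub, Prod.snd_sub, Pi.sub_apply, mul_sub, Finset.sum_sub_distrib]
    ring
  rw [lieVF, hsub]
  linarith

/-- Decomposition of a vector of `ker η^R` along the frame `∂_{x_i} + y_i ∂_z`, `∂_{y_i}`. -/
lemma eq_sum_of_etaR_eq_zero {n : ℕ} {p v : Heis n} (hv : etaR p v = 0) :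
    v = ∑ i, v.1 i • ((Pi.single i 1, 0, 0) + p.2.1 i • (0, 0, 1) : Heis n) +
      ∑ i, v.2.1 i • ((0, Pi.single i 1, 0) : Heis n) := by
  have hz : v.2.2 = ∑ i, p.2.1 i * v.1 i := sub_eq_zero.1 hv
  refine Prod.ext ?_ (Prod.ext ?_ ?_)
  · ext j
    simp [Prod.fst_sum, Finset.sum_apply, Pi.single_apply]
  · ext j
    simp [Prod.fst_sum, Prod.snd_sum, Finset.sum_apply, Pi.single_apply]
  · simp [Prod.snd_sum, hz, mul_comm]

/-- A smooth vector field `X` on `ℝ^{2n+1}` preserves the contact distribution `ker η^R`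
if and only if it is the contact Hamiltonian vector field of `F(p) = η^R_p(X(p))`. -/
theorem stmt1 (n : ℕ) (X : Heis n → Heis n) (hX : ContDiff ℝ (⊤ : ℕ∞) X) :
    (∀ Y : Heis n → Heis n, ContDiff ℝ (⊤ : ℕ∞) Y → (∀ p, etaR p (Y p) = 0) →
      ∀ p, etaR p (lieVF X Y p) = 0) ↔
    X = hamVF (fun p => etaR p (X p)) := by
  have hXd : Differentiable ℝ X := hX.differentiable (by simp)
  constructor
  · intro h
    funext p
    have hx (i : Fin n) : (X p).1 i =
        -fderiv ℝ (fun q => etaR q (X q)) p (0, Pi.single i 1, 0) := by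
      let Y : Heis n → Heis n := fun _ => (0, Pi.single i 1, 0)
      have hY : ContDiff ℝ (⊤ : ℕ∞) Y := contDiff_const
      have hYker (q : Heis n) : etaR q (Y q) = 0 := by simp [etaR, Y]
      have key := etaR_lieVF hXd (hY.differentiable (by simp)) hYker p
      rw [h Y hY hYker p] at key
      simp [Y, Pi.single_apply] at key
      linarith
    have hy (i : Fin n) : (X p).2.1 i =
        p.2.1 i * fderiv ℝ (fun q => etaR q (X q)) p (0, 0, 1) +
          fderiv ℝ (fun q => etaR q (X q)) p (Pi.single i 1, 0, 0) := by
      let Y : Heis n → Heis n := fun q => (Pi.single i 1, 0, 0) + q.2.1 i • (0, 0, 1)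
      have hY : ContDiff ℝ (⊤ : ℕ∞) Y := by fun_prop
      have hYker (q : Heis n) : etaR q (Y q) = 0 := by simp [etaR, Y, Pi.single_apply]
      have key := etaR_lieVF hXd (hY.differentiable (by simp)) hYker p
      rw [h Y hY hYker p] at key
      simp only [Y, map_add, map_smul] at key
      simp [Pi.single_apply] at key
      linarith
    refine Prod.ext (funext hx) (Prod.ext (funext hy) ?_)
    simp only [hamVF, ← neg_eq_iff_eq_neg.2 (hx _)]
    simp [etaR]
  · intro h Y hY hYker p
    have hx (i : Fin n) := congrFun (congrArg Prod.fst (congrFun h p)) i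
    have hy (i : Fin n) := congrFun (congrArg (fun v => v.2.1) (congrFun h p)) i
    simp only [hamVF] at hx hy
    rw [etaR_lieVF hXd (hY.differentiable (by simp)) hYker]
    generalize fderiv ℝ (fun q => etaR q (X q)) p = L at hx hy ⊢
    rw [congrArg L (eq_sum_of_etaR_eq_zero (hYker p))]
    simp only [hx, hy, map_add, map_sum, map_smul, smul_eq_mul, mul_neg, Finset.sum_neg_distrib,
      sub_neg_eq_add]
    rw [add_sub_add_right_eq_sub, sub_eq_zero]
    exact Finset.sum_congr rfl fun i _ => by ring
end

section
/- Each of the vector fields ξ, R_i, S_i (1 ≤ i ≤ n), X_{ij} (1 ≤ i ≤ j ≤ n), Y_{ij} (1 ≤ i < j ≤ n), and D on ℝ^{2n+1} is complete: for every point p ∈ ℝ^{2n+1} there exists a smooth curve γ : ℝ → ℝ^{2n+1} with γ(0) = p and γ'(t) = X(γ(t)) for all t ∈ ℝ. -/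
/-- `ξ = ∂_z`. -/
def xiVF {n : ℕ} : Heis n → Heis n := fun _ => (0, 0, 1)

/-- `R_i = ∂_{x_i}`. -/
def Rf {n : ℕ} (i : Fin n) : Heis n → Heis n := fun _ => (Pi.single i 1, 0, 0)

/-- `S_i = ∂_{y_i} + x_i ∂_z`. -/
def Sf {n : ℕ} (i : Fin n) : Heis n → Heis n := fun p => (0, Pi.single i 1, p.1 i)

/-- `X_{ij} = x_i∂_{y_j} + x_j∂_{y_i} − y_i∂_{x_j} − y_j∂_{x_i} + (x_ix_j − y_iy_j)∂_z`. -/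
def Xf {n : ℕ} (i j : Fin n) : Heis n → Heis n := fun p =>
  (fun k => -(p.2.1 i * (if k = j then 1 else 0)) - p.2.1 j * (if k = i then 1 else 0),
   fun k => p.1 i * (if k = j then 1 else 0) + p.1 j * (if k = i then 1 else 0),
   p.1 i * p.1 j - p.2.1 i * p.2.1 j)

/-- `Y_{ij} = x_i∂_{x_j} − x_j∂_{x_i} + y_i∂_{y_j} − y_j∂_{y_i}`. -/
def Yf {n : ℕ} (i j : Fin n) : Heis n → Heis n := fun p =>
  (fun k => p.1 i * (if k = j then 1 else 0) - p.1 j * (if k = i then 1 else 0),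
   fun k => p.2.1 i * (if k = j then 1 else 0) - p.2.1 j * (if k = i then 1 else 0),
   0)

/-- The dilation vector field `D = 2z∂_z + Σ_k (x_k∂_{x_k} + y_k∂_{y_k})`. -/
def DilVF {n : ℕ} : Heis n → Heis n := fun p => (p.1, p.2.1, 2 * p.2.2)

/-- The generators of the Lie algebra of infinitesimal CR transformations of `ℍ^{2n+1}`. -/
def crGens (n : ℕ) : Set (Heis n → Heis n) :=
  {xiVF} ∪ Set.range Rf ∪ Set.range Sf ∪
    {V | ∃ i j : Fin n, i ≤ j ∧ V = Xf i j} ∪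
    {V | ∃ i j : Fin n, i < j ∧ V = Yf i j} ∪ {DilVF}

/-- A curve in `Heis n` with smooth coordinates solving the coordinate equations of `V` is a
global smooth integral curve of `V`. -/
theorem exists_integralCurve_of_coords {n : ℕ} {V : Heis n → Heis n} {p : Heis n}
    (x y : ℝ → Fin n → ℝ) (z : ℝ → ℝ)
    (hx : ∀ k, ContDiff ℝ (⊤ : ℕ∞) fun t => x t k)
    (hy : ∀ k, ContDiff ℝ (⊤ : ℕ∞) fun t => y t k) (hz : ContDiff ℝ (⊤ : ℕ∞) z)
    (h0 : (x 0, y 0, z 0) = p)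
    (hx' : ∀ t k, HasDerivAt (fun s => x s k) ((V (x t, y t, z t)).1 k) t)
    (hy' : ∀ t k, HasDerivAt (fun s => y s k) ((V (x t, y t, z t)).2.1 k) t)
    (hz' : ∀ t, HasDerivAt z (V (x t, y t, z t)).2.2 t) :
    ∃ γ : ℝ → Heis n, ContDiff ℝ (⊤ : ℕ∞) γ ∧ γ 0 = p ∧ ∀ t : ℝ, HasDerivAt γ (V (γ t)) t :=
  ⟨fun t => (x t, y t, z t), (contDiff_pi.2 hx).prodMk ((contDiff_pi.2 hy).prodMk hz), h0,
    fun t => (hasDerivAt_pi.2 (hx' t)).prodMk ((hasDerivAt_pi.2 (hy' t)).prodMk (hz' t))⟩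

theorem hasDerivAt_cos_sin_combination (a b w t : ℝ) :
    HasDerivAt (fun s => a * Real.cos (w * s) + b * Real.sin (w * s))
      (w * (b * Real.cos (w * t) - a * Real.sin (w * t))) t := by
  have h : HasDerivAt (fun s : ℝ => w * s) w t := by
    simpa using (hasDerivAt_id t).const_mul w
  exact ((h.cos.const_mul a).add (h.sin.const_mul b)).congr_deriv (by ring)

/-- A primitive of a quadratic form in `cos (w s)` and `sin (w s)`. -/
theorem hasDerivAt_sin_cos_quadratic (z a b w t : ℝ) :
    HasDerivAt
      (fun s => z + a * (Real.sin (w * s) * Real.cos (w * s)) - b * Real.sin (w * s) ^ 2)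
      (w * (a * (Real.cos (w * t) ^ 2 - Real.sin (w * t) ^ 2)
        - 2 * b * (Real.sin (w * t) * Real.cos (w * t)))) t := by
  have h : HasDerivAt (fun s : ℝ => w * s) w t := by
    simpa using (hasDerivAt_id t).const_mul w
  exact ((((h.sin.mul h.cos).const_mul a).const_add z).sub
    ((h.sin.pow 2).const_mul b)).congr_deriv (by push_cast; ring)

/-- The coordinates `i` and `j` of `v` replaced by `f` and `g`, with `j` taking precedence. -/
def replaceTwo {n : ℕ} (i j : Fin n) (v : Fin n → ℝ) (f g : ℝ → ℝ) (t : ℝ) (k : Fin n) : ℝ :=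
  if k = j then g t else if k = i then f t else v k

theorem contDiff_replaceTwo {n : ℕ} (i j : Fin n) (v : Fin n → ℝ) {f g : ℝ → ℝ}
    (hf : ContDiff ℝ (⊤ : ℕ∞) f) (hg : ContDiff ℝ (⊤ : ℕ∞) g) (k : Fin n) :
    ContDiff ℝ (⊤ : ℕ∞) fun t => replaceTwo i j v f g t k := by
  unfold replaceTwo
  split_ifs
  exacts [hg, hf, contDiff_const]

theorem hasDerivAt_replaceTwo {n : ℕ} (i j : Fin n) (v : Fin n → ℝ) {f g : ℝ → ℝ} {f' g' t : ℝ}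
    (hf : HasDerivAt f f' t) (hg : HasDerivAt g g' t) (k : Fin n) :
    HasDerivAt (fun s => replaceTwo i j v f g s k)
      (if k = j then g' else if k = i then f' else 0) t := by
  unfold replaceTwo
  split_ifs
  exacts [hg, hf, hasDerivAt_const t _]

theorem replaceTwo_zero {n : ℕ} (i j : Fin n) (v : Fin n → ℝ) {f g : ℝ → ℝ}
    (hf : f 0 = v i) (hg : g 0 = v j) : replaceTwo i j v f g 0 = v := by
  funext k
  unfold replaceTwo
  split_ifs with h₁ h₂
  · rw [hg, h₁]
  · rw [hf, h₂]
  · rfl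

theorem exists_integralCurve_xiVF {n : ℕ} (p : Heis n) :
    ∃ γ : ℝ → Heis n, ContDiff ℝ (⊤ : ℕ∞) γ ∧ γ 0 = p ∧
      ∀ t : ℝ, HasDerivAt γ (xiVF (γ t)) t :=
  exists_integralCurve_of_coords (fun _ => p.1) (fun _ => p.2.1) (fun t => p.2.2 + t)
    (fun k => by fun_prop) (fun k => by fun_prop) (by fun_prop) (by simp)
    (fun t k => hasDerivAt_const t _) (fun t k => hasDerivAt_const t _)
    (fun t => (hasDerivAt_id t).const_add _)

theorem exists_integralCurve_Rf {n : ℕ} (i : Fin n) (p : Heis n) :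
    ∃ γ : ℝ → Heis n, ContDiff ℝ (⊤ : ℕ∞) γ ∧ γ 0 = p ∧
      ∀ t : ℝ, HasDerivAt γ (Rf i (γ t)) t := by
  refine exists_integralCurve_of_coords (fun t k => p.1 k + t * (Pi.single i 1 : Fin n → ℝ) k)
    (fun _ => p.2.1) (fun _ => p.2.2)
    (fun k => by fun_prop) (fun k => by fun_prop) (by fun_prop) (by simp)
    (fun t k => ?_) (fun t k => hasDerivAt_const t _) (fun t => hasDerivAt_const t _)
  exact (((hasDerivAt_id t).mul_const _).const_add _).congr_deriv (one_mul _)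

theorem exists_integralCurve_Sf {n : ℕ} (i : Fin n) (p : Heis n) :
    ∃ γ : ℝ → Heis n, ContDiff ℝ (⊤ : ℕ∞) γ ∧ γ 0 = p ∧
      ∀ t : ℝ, HasDerivAt γ (Sf i (γ t)) t := by
  refine exists_integralCurve_of_coords (fun _ => p.1)
    (fun t k => p.2.1 k + t * (Pi.single i 1 : Fin n → ℝ) k) (fun t => p.2.2 + t * p.1 i)
    (fun k => by fun_prop) (fun k => by fun_prop) (by fun_prop) (by simp)
    (fun t k => hasDerivAt_const t _) (fun t k => ?_) (fun t => ?_) <;>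
  exact (((hasDerivAt_id t).mul_const _).const_add _).congr_deriv (one_mul _)

theorem exists_integralCurve_DilVF {n : ℕ} (p : Heis n) :
    ∃ γ : ℝ → Heis n, ContDiff ℝ (⊤ : ℕ∞) γ ∧ γ 0 = p ∧
      ∀ t : ℝ, HasDerivAt γ (DilVF (γ t)) t := by
  refine exists_integralCurve_of_coords (fun t k => p.1 k * Real.exp t)
    (fun t k => p.2.1 k * Real.exp t) (fun t => p.2.2 * Real.exp (2 * t))
    (fun k => by fun_prop) (fun k => by fun_prop) (by fun_prop) (by simp)
    (fun t k => (Real.hasDerivAt_exp t).const_mul _)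
    (fun t k => (Real.hasDerivAt_exp t).const_mul _) (fun t => ?_)
  exact (((hasDerivAt_id t).const_mul 2).exp.const_mul _).congr_deriv
    (by simp only [DilVF, id]; ring)

theorem exists_integralCurve_Yf {n : ℕ} {i j : Fin n} (hij : i ≠ j) (p : Heis n) :
    ∃ γ : ℝ → Heis n, ContDiff ℝ (⊤ : ℕ∞) γ ∧ γ 0 = p ∧
      ∀ t : ℝ, HasDerivAt γ (Yf i j (γ t)) t := by
  refine exists_integralCurve_of_coords
    (replaceTwo i j p.1 (fun s => p.1 i * Real.cos (1 * s) + -p.1 j * Real.sin (1 * s))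
      (fun s => p.1 j * Real.cos (1 * s) + p.1 i * Real.sin (1 * s)))
    (replaceTwo i j p.2.1 (fun s => p.2.1 i * Real.cos (1 * s) + -p.2.1 j * Real.sin (1 * s))
      (fun s => p.2.1 j * Real.cos (1 * s) + p.2.1 i * Real.sin (1 * s)))
    (fun _ => p.2.2)
    (contDiff_replaceTwo _ _ _ (by fun_prop) (by fun_prop))
    (contDiff_replaceTwo _ _ _ (by fun_prop) (by fun_prop)) contDiff_const
    (by rw [replaceTwo_zero _ _ _ (by simp) (by simp), replaceTwo_zero _ _ _ (by simp) (by simp)])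
    (fun t k => ?_) (fun t k => ?_) (fun t => hasDerivAt_const t _) <;>
  · refine (hasDerivAt_replaceTwo i j _ (hasDerivAt_cos_sin_combination _ _ _ _)
      (hasDerivAt_cos_sin_combination _ _ _ _) k).congr_deriv ?_
    rcases eq_or_ne k j with rfl | hj
    · simp [Yf, replaceTwo, hij, hij.symm]
      ring
    · rcases eq_or_ne k i with rfl | hi
      · simp [Yf, replaceTwo, hij]
        ring
      · simp [Yf, hi, hj]

theorem exists_integralCurve_Xf_of_ne {n : ℕ} {i j : Fin n} (hij : i ≠ j) (p : Heis n) :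
    ∃ γ : ℝ → Heis n, ContDiff ℝ (⊤ : ℕ∞) γ ∧ γ 0 = p ∧
      ∀ t : ℝ, HasDerivAt γ (Xf i j (γ t)) t := by
  refine exists_integralCurve_of_coords
    (replaceTwo i j p.1 (fun s => p.1 i * Real.cos (1 * s) + -p.2.1 j * Real.sin (1 * s))
      (fun s => p.1 j * Real.cos (1 * s) + -p.2.1 i * Real.sin (1 * s)))
    (replaceTwo i j p.2.1 (fun s => p.2.1 i * Real.cos (1 * s) + p.1 j * Real.sin (1 * s))
      (fun s => p.2.1 j * Real.cos (1 * s) + p.1 i * Real.sin (1 * s)))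
    (fun s => p.2.2 + (p.1 i * p.1 j - p.2.1 i * p.2.1 j) * (Real.sin (1 * s) * Real.cos (1 * s))
      - (p.1 i * p.2.1 i + p.1 j * p.2.1 j) * Real.sin (1 * s) ^ 2)
    (contDiff_replaceTwo _ _ _ (by fun_prop) (by fun_prop))
    (contDiff_replaceTwo _ _ _ (by fun_prop) (by fun_prop)) (by fun_prop)
    (by rw [replaceTwo_zero _ _ _ (by simp) (by simp), replaceTwo_zero _ _ _ (by simp) (by simp)]
        simp)
    (fun t k => ?_) (fun t k => ?_)
    (fun t => (hasDerivAt_sin_cos_quadratic _ _ _ _ _).congr_deriv ?_)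
  on_goal 3 =>
    simp [Xf, replaceTwo, hij]
    ring
  all_goals
    refine (hasDerivAt_replaceTwo i j _ (hasDerivAt_cos_sin_combination _ _ _ _)
      (hasDerivAt_cos_sin_combination _ _ _ _) k).congr_deriv ?_
    rcases eq_or_ne k j with rfl | hj
    · simp [Xf, replaceTwo, hij, hij.symm]
      ring
    · rcases eq_or_ne k i with rfl | hi
      · simp [Xf, replaceTwo, hij]
        ring
      · simp [Xf, hi, hj]

theorem exists_integralCurve_Xf_self {n : ℕ} (i : Fin n) (p : Heis n) :
    ∃ γ : ℝ → Heis n, ContDiff ℝ (⊤ : ℕ∞) γ ∧ γ 0 = p ∧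
      ∀ t : ℝ, HasDerivAt γ (Xf i i (γ t)) t := by
  let f : ℝ → ℝ := fun s => p.1 i * Real.cos (2 * s) + -p.2.1 i * Real.sin (2 * s)
  let g : ℝ → ℝ := fun s => p.2.1 i * Real.cos (2 * s) + p.1 i * Real.sin (2 * s)
  have hf : ContDiff ℝ (⊤ : ℕ∞) f := by fun_prop
  have hg : ContDiff ℝ (⊤ : ℕ∞) g := by fun_prop
  refine exists_integralCurve_of_coords (replaceTwo i i p.1 f f) (replaceTwo i i p.2.1 g g)
    (fun s => p.2.2 + (p.1 i ^ 2 - p.2.1 i ^ 2) / 2 * (Real.sin (2 * s) * Real.cos (2 * s))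
      - (p.1 i * p.2.1 i) * Real.sin (2 * s) ^ 2)
    (contDiff_replaceTwo _ _ _ hf hf) (contDiff_replaceTwo _ _ _ hg hg) (by fun_prop)
    (by rw [replaceTwo_zero _ _ _ (by simp [f]) (by simp [f]),
          replaceTwo_zero _ _ _ (by simp [g]) (by simp [g])]
        simp)
    (fun t k => ?_) (fun t k => ?_)
    (fun t => (hasDerivAt_sin_cos_quadratic _ _ _ _ _).congr_deriv ?_)
  on_goal 3 =>
    simp [Xf, replaceTwo, f, g]
    ring
  all_goals
    refine (hasDerivAt_replaceTwo i i _ (hasDerivAt_cos_sin_combination _ _ _ _)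
      (hasDerivAt_cos_sin_combination _ _ _ _) k).congr_deriv ?_
    rcases eq_or_ne k i with rfl | hi
    · simp [Xf, replaceTwo, f, g]
      ring
    · simp [Xf, hi]

/-- Each of the vector fields `ξ, R_i, S_i, X_{ij} (i ≤ j), Y_{ij} (i < j), D` is complete:
through every point there is a globally defined smooth integral curve. -/
theorem stmt3 (n : ℕ) :
    ∀ X ∈ crGens n, ∀ p : Heis n,
      ∃ γ : ℝ → Heis n, ContDiff ℝ (⊤ : ℕ∞) γ ∧ γ 0 = p ∧
        ∀ t : ℝ, HasDerivAt γ (X (γ t)) t := by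
  rintro X (((((rfl | ⟨i, rfl⟩) | ⟨i, rfl⟩) | ⟨i, j, -, rfl⟩) | ⟨i, j, hij, rfl⟩) | rfl) p
  · exact exists_integralCurve_xiVF p
  · exact exists_integralCurve_Rf i p
  · exact exists_integralCurve_Sf i p
  · rcases eq_or_ne i j with rfl | hij
    · exact exists_integralCurve_Xf_self i p
    · exact exists_integralCurve_Xf_of_ne hij p
  · exact exists_integralCurve_Yf hij.ne p
  · exact exists_integralCurve_DilVF p
end

section
/- The real span g of the n² + 2n + 2 vector fields ξ, R_i, S_i (1 ≤ i ≤ n), X_{ij} (1 ≤ i ≤ j ≤ n), Y_{ij} (1 ≤ i < j ≤ n), D is closed under the Lie bracket of vector fields; these vector fields are linearly independent over ℝ (so dim g = n² + 2n + 2); and the span h of {ξ, R_1,…,R_n, S_1,…,S_n} is an ideal of g, i.e. [X,H] ∈ h for all X ∈ g and H ∈ h. -/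
/-- Index type for the `n² + 2n + 2` generators `ξ, R_i, S_i, X_{ij} (i ≤ j),
`Y_{ij} (i < j)`, `D`. -/
def CRIdx (n : ℕ) : Type :=
  Unit ⊕ Fin n ⊕ Fin n ⊕ {q : Fin n × Fin n // q.1 ≤ q.2} ⊕ {q : Fin n × Fin n // q.1 < q.2} ⊕ Unit

/-- The family of generating vector fields. -/
def crFam (n : ℕ) : CRIdx n → (Heis n → Heis n) := fun k =>
  match k with
  | Sum.inl _ => xiVF
  | Sum.inr (Sum.inl i) => Rf i
  | Sum.inr (Sum.inr (Sum.inl i)) => Sf i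
  | Sum.inr (Sum.inr (Sum.inr (Sum.inl q))) => Xf q.1.1 q.1.2
  | Sum.inr (Sum.inr (Sum.inr (Sum.inr (Sum.inl q)))) => Yf q.1.1 q.1.2
  | Sum.inr (Sum.inr (Sum.inr (Sum.inr (Sum.inr _)))) => DilVF

namespace Heis

variable {n : ℕ}

theorem hasFDerivAt_x (i : Fin n) (p : Heis n) :
    HasFDerivAt (fun q : Heis n => q.1 i)
      ((ContinuousLinearMap.proj i).comp (ContinuousLinearMap.fst ℝ (Fin n → ℝ) _)) p :=
  hasFDerivAt_pi'.1 hasFDerivAt_fst i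

theorem hasFDerivAt_y (i : Fin n) (p : Heis n) :
    HasFDerivAt (fun q : Heis n => q.2.1 i)
      ((ContinuousLinearMap.proj i).comp ((ContinuousLinearMap.fst ℝ (Fin n → ℝ) ℝ).comp
        (ContinuousLinearMap.snd ℝ (Fin n → ℝ) _))) p :=
  hasFDerivAt_pi'.1 hasFDerivAt_snd.fst i

theorem differentiable_crFam (k : CRIdx n) : Differentiable ℝ (crFam n k) := by
  rcases k with _ | i | i | q | q | _ <;>
    unfold crFam <;> simp only <;>
    (first | unfold xiVF | unfold Rf | unfold Sf | unfold Xf | unfold Yf | unfold DilVF) <;>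
    fun_prop

theorem fderiv_xiVF (p v : Heis n) : fderiv ℝ (xiVF (n := n)) p v = 0 := by
  unfold xiVF; simp

theorem fderiv_Rf (i : Fin n) (p v : Heis n) : fderiv ℝ (Rf i) p v = 0 := by
  unfold Rf; simp

theorem fderiv_Sf (i : Fin n) (p v : Heis n) : fderiv ℝ (Sf i) p v = (0, 0, v.1 i) := by
  have h : HasFDerivAt (Sf i) _ p :=
    (hasFDerivAt_const (0 : Fin n → ℝ) p).prodMk
      ((hasFDerivAt_const (Pi.single i 1 : Fin n → ℝ) p).prodMk (hasFDerivAt_x i p))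
  rw [h.fderiv]
  simp

theorem fderiv_Xf (i j : Fin n) (p v : Heis n) :
    fderiv ℝ (Xf i j) p v =
      (fun k => -(v.2.1 i * (if k = j then 1 else 0)) - v.2.1 j * (if k = i then 1 else 0),
       fun k => v.1 i * (if k = j then 1 else 0) + v.1 j * (if k = i then 1 else 0),
       p.1 i * v.1 j + p.1 j * v.1 i - (p.2.1 i * v.2.1 j + p.2.1 j * v.2.1 i)) := by
  have h : HasFDerivAt (Xf i j) _ p :=
    (hasFDerivAt_pi.2 fun k => ((hasFDerivAt_y i p).mul_const (if k = j then 1 else 0)).neg.sub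
      ((hasFDerivAt_y j p).mul_const (if k = i then 1 else 0))).prodMk
    ((hasFDerivAt_pi.2 fun k => ((hasFDerivAt_x i p).mul_const (if k = j then 1 else 0)).add
      ((hasFDerivAt_x j p).mul_const (if k = i then 1 else 0))).prodMk
    (((hasFDerivAt_x i p).mul (hasFDerivAt_x j p)).sub
      ((hasFDerivAt_y i p).mul (hasFDerivAt_y j p))))
  rw [h.fderiv]
  ext <;> simp [mul_comm, -ite_smul]

theorem fderiv_Yf (i j : Fin n) (p v : Heis n) : fderiv ℝ (Yf i j) p v = Yf i j v := by
  have h : HasFDerivAt (Yf i j) _ p :=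
    (hasFDerivAt_pi.2 fun k => ((hasFDerivAt_x i p).mul_const (if k = j then 1 else 0)).sub
      ((hasFDerivAt_x j p).mul_const (if k = i then 1 else 0))).prodMk
    ((hasFDerivAt_pi.2 fun k => ((hasFDerivAt_y i p).mul_const (if k = j then 1 else 0)).sub
      ((hasFDerivAt_y j p).mul_const (if k = i then 1 else 0))).prodMk
    (hasFDerivAt_const (0 : ℝ) p))
  rw [h.fderiv]
  ext <;> simp [Yf, mul_comm, -ite_smul]

theorem fderiv_DilVF (p v : Heis n) : fderiv ℝ (DilVF (n := n)) p v = DilVF v := by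
  have h : HasFDerivAt (DilVF (n := n)) _ p :=
    have hs := hasFDerivAt_snd (𝕜 := ℝ) (p := p)
    hasFDerivAt_fst.prodMk (hs.fst.prodMk (hs.snd.const_mul (2 : ℝ)))
  rw [h.fderiv]
  simp [DilVF]

theorem lieVF_swap (V W : Heis n → Heis n) : lieVF V W = -lieVF W V := by
  ext p <;> simp [lieVF]

theorem differentiable_of_mem_span {T : Set (Heis n → Heis n)}
    (hT : ∀ W ∈ T, Differentiable ℝ W) {W : Heis n → Heis n} (hW : W ∈ Submodule.span ℝ T) :
    Differentiable ℝ W := by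
  induction hW using Submodule.span_induction with
  | mem W hW => exact hT W hW
  | zero => exact differentiable_const 0
  | add A B _ _ hA hB => exact hA.add hB
  | smul c A _ hA => exact hA.const_smul c

theorem lieVF_mem_of_mem_span_right {T : Set (Heis n → Heis n)}
    {M : Submodule ℝ (Heis n → Heis n)} (hT : ∀ W ∈ T, Differentiable ℝ W)
    {V W : Heis n → Heis n} (h : ∀ W ∈ T, lieVF V W ∈ M) (hW : W ∈ Submodule.span ℝ T) :
    lieVF V W ∈ M := by
  induction hW using Submodule.span_induction with
  | mem W hW => exact h W hW
  | zero =>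
    convert M.zero_mem
    ext p <;> simp [lieVF]
  | add A B hA hB ihA ihB =>
    convert M.add_mem ihA ihB using 1
    funext p
    simp only [lieVF, Pi.add_apply, fderiv_add (differentiable_of_mem_span hT hA p)
      (differentiable_of_mem_span hT hB p), map_add, add_apply]
    abel
  | smul c A hA ihA =>
    convert M.smul_mem c ihA using 1
    funext p
    simp only [lieVF, Pi.smul_apply, fderiv_const_smul (differentiable_of_mem_span hT hA p),
      map_smul, smul_apply, smul_sub]

theorem lieVF_mem_of_mem_span {S T : Set (Heis n → Heis n)}
    {M : Submodule ℝ (Heis n → Heis n)} (hS : ∀ V ∈ S, Differentiable ℝ V)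
    (hT : ∀ W ∈ T, Differentiable ℝ W) (h : ∀ V ∈ S, ∀ W ∈ T, lieVF V W ∈ M)
    {V W : Heis n → Heis n} (hV : V ∈ Submodule.span ℝ S) (hW : W ∈ Submodule.span ℝ T) :
    lieVF V W ∈ M := by
  refine lieVF_mem_of_mem_span_right hT (fun B hB => ?_) hW
  rw [lieVF_swap]
  refine M.neg_mem (lieVF_mem_of_mem_span_right hS (fun A hA => ?_) hV)
  rw [lieVF_swap]
  exact M.neg_mem (h A hA B hB)

theorem ite_eq_swap (i j : Fin n) :
    (if i = j then (1 : ℝ) else 0) = if j = i then 1 else 0 := by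
  simp only [eq_comm]

theorem lieVF_Xf_Xf (i j k l : Fin n) :
    lieVF (Xf i j) (Xf k l) =
      -((if i = l then (1 : ℝ) else 0) • Yf j k + (if j = l then (1 : ℝ) else 0) • Yf i k +
        (if i = k then (1 : ℝ) else 0) • Yf j l + (if j = k then (1 : ℝ) else 0) • Yf i l) := by
  ext p <;>
    simp only [lieVF, fderiv_Xf, Prod.fst_sub, Prod.snd_sub, Pi.sub_apply, Pi.neg_apply,
      Pi.add_apply, Pi.smul_apply, Prod.fst_neg, Prod.snd_neg, Prod.fst_add, Prod.snd_add,
      Prod.smul_fst, Prod.smul_snd, smul_eq_mul, Xf, Yf, ite_eq_swap k i, ite_eq_swap k j,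
      ite_eq_swap l i, ite_eq_swap l j] <;>
    ring

theorem lieVF_Xf_Yf (i j k l : Fin n) :
    lieVF (Xf i j) (Yf k l) =
      (if i = k then (1 : ℝ) else 0) • Xf l j + (if j = k then (1 : ℝ) else 0) • Xf l i -
        (if i = l then (1 : ℝ) else 0) • Xf k j - (if j = l then (1 : ℝ) else 0) • Xf k i := by
  ext p <;>
    simp only [lieVF, fderiv_Xf, fderiv_Yf, Prod.fst_sub, Prod.snd_sub, Pi.sub_apply,
      Pi.add_apply, Pi.smul_apply, Prod.fst_add, Prod.snd_add,
      Prod.smul_fst, Prod.smul_snd, smul_eq_mul, Xf, Yf, ite_eq_swap k i, ite_eq_swap k j,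
      ite_eq_swap l i, ite_eq_swap l j] <;>
    ring

theorem lieVF_Yf_Yf (i j k l : Fin n) :
    lieVF (Yf i j) (Yf k l) =
      (if j = k then (1 : ℝ) else 0) • Yf i l - (if i = k then (1 : ℝ) else 0) • Yf j l -
        (if j = l then (1 : ℝ) else 0) • Yf i k + (if i = l then (1 : ℝ) else 0) • Yf j k := by
  ext p <;>
    simp only [lieVF, fderiv_Yf, Prod.fst_sub, Prod.snd_sub, Pi.sub_apply,
      Pi.add_apply, Pi.smul_apply, Prod.fst_add, Prod.snd_add,
      Prod.smul_fst, Prod.smul_snd, smul_eq_mul, Yf, ite_eq_swap k i, ite_eq_swap k j,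
      ite_eq_swap l i, ite_eq_swap l j] <;>
    ring

theorem lieVF_DilVF_Xf (i j : Fin n) : lieVF DilVF (Xf i j) = 0 := by
  ext p <;> simp [lieVF, fderiv_Xf, fderiv_DilVF, DilVF, Xf]
  ring

theorem lieVF_DilVF_Yf (i j : Fin n) : lieVF DilVF (Yf i j) = 0 := by
  ext p <;> simp [lieVF, fderiv_Yf, fderiv_DilVF, DilVF, Yf]

theorem lieVF_self (V : Heis n → Heis n) : lieVF V V = 0 := by
  ext p <;> simp [lieVF]

theorem lieVF_Rf_xiVF (i : Fin n) : lieVF (Rf i) xiVF = 0 := by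
  ext p <;> simp [lieVF, fderiv_Rf, fderiv_xiVF]

theorem lieVF_Sf_xiVF (i : Fin n) : lieVF (Sf i) xiVF = 0 := by
  ext p <;> simp [lieVF, fderiv_Sf, fderiv_xiVF, xiVF]

theorem lieVF_Xf_xiVF (i j : Fin n) : lieVF (Xf i j) xiVF = 0 := by
  ext p <;> simp [lieVF, fderiv_Xf, fderiv_xiVF, xiVF]

theorem lieVF_Yf_xiVF (i j : Fin n) : lieVF (Yf i j) xiVF = 0 := by
  ext p <;> simp [lieVF, fderiv_Yf, fderiv_xiVF, xiVF, Yf]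

theorem lieVF_DilVF_xiVF : lieVF (n := n) DilVF xiVF = (-2 : ℝ) • xiVF := by
  ext p <;> simp [lieVF, fderiv_DilVF, fderiv_xiVF, xiVF, DilVF]

theorem lieVF_Rf_Rf (i k : Fin n) : lieVF (Rf i) (Rf k) = 0 := by
  ext p <;> simp [lieVF, fderiv_Rf]

theorem lieVF_Sf_Rf (i k : Fin n) :
    lieVF (Sf i) (Rf k) = -((if i = k then (1 : ℝ) else 0) • xiVF) := by
  ext p <;> simp [lieVF, fderiv_Rf, fderiv_Sf, Rf, xiVF, Pi.single_apply, -ite_smul, -mul_ite, -ite_mul]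

theorem lieVF_Xf_Rf (i j k : Fin n) :
    lieVF (Xf i j) (Rf k) =
      -((if i = k then (1 : ℝ) else 0) • Sf j + (if j = k then (1 : ℝ) else 0) • Sf i) := by
  ext p <;> simp [lieVF, fderiv_Rf, fderiv_Xf, Rf, Sf, Pi.single_apply, -ite_smul, -mul_ite, -ite_mul]
  ring

theorem lieVF_Yf_Rf (i j k : Fin n) :
    lieVF (Yf i j) (Rf k) =
      (if j = k then (1 : ℝ) else 0) • Rf i - (if i = k then (1 : ℝ) else 0) • Rf j := by
  ext p <;> simp [lieVF, fderiv_Rf, fderiv_Yf, Rf, Yf, Pi.single_apply, -ite_smul, -mul_ite, -ite_mul]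

theorem lieVF_DilVF_Rf (k : Fin n) : lieVF DilVF (Rf k) = -Rf k := by
  ext p <;> simp [lieVF, fderiv_Rf, fderiv_DilVF, Rf, DilVF]

theorem lieVF_Sf_Sf (i k : Fin n) : lieVF (Sf i) (Sf k) = 0 := by
  ext p <;> simp [lieVF, fderiv_Sf, Sf]

theorem lieVF_Xf_Sf (i j k : Fin n) :
    lieVF (Xf i j) (Sf k) =
      (if i = k then (1 : ℝ) else 0) • Rf j + (if j = k then (1 : ℝ) else 0) • Rf i := by
  ext p <;>
    simp [lieVF, fderiv_Sf, fderiv_Xf, Rf, Xf, Sf, Pi.single_apply, @eq_comm _ k, -ite_smul, -mul_ite, -ite_mul] <;> ring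

theorem lieVF_Yf_Sf (i j k : Fin n) :
    lieVF (Yf i j) (Sf k) =
      (if j = k then (1 : ℝ) else 0) • Sf i - (if i = k then (1 : ℝ) else 0) • Sf j := by
  ext p <;>
    simp [lieVF, fderiv_Sf, fderiv_Yf, Yf, Sf, Pi.single_apply, @eq_comm _ k, -ite_smul, -mul_ite, -ite_mul]
  ring

theorem lieVF_DilVF_Sf (k : Fin n) : lieVF DilVF (Sf k) = -Sf k := by
  ext p <;> simp [lieVF, fderiv_Sf, fderiv_DilVF, Sf, DilVF]
  ring

theorem Xf_comm (i j : Fin n) : Xf i j = Xf j i := by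
  ext p <;> simp only [Xf] <;> ring

theorem Yf_swap (i j : Fin n) : Yf i j = -Yf j i := by
  ext p <;> simp [Yf]

theorem Xf_mem (i j : Fin n) : Xf i j ∈ Submodule.span ℝ (Set.range (crFam n)) := by
  rcases le_total i j with h | h
  · exact Submodule.subset_span ⟨Sum.inr (Sum.inr (Sum.inr (Sum.inl ⟨(i, j), h⟩))), rfl⟩
  · rw [Xf_comm]
    exact Submodule.subset_span ⟨Sum.inr (Sum.inr (Sum.inr (Sum.inl ⟨(j, i), h⟩))), rfl⟩

theorem Yf_mem (i j : Fin n) : Yf i j ∈ Submodule.span ℝ (Set.range (crFam n)) := by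
  rcases lt_trichotomy i j with h | rfl | h
  · exact Submodule.subset_span ⟨Sum.inr (Sum.inr (Sum.inr (Sum.inr (Sum.inl ⟨(i, j), h⟩)))), rfl⟩
  · convert Submodule.zero_mem _
    ext p <;> simp [Yf]
  · rw [Yf_swap]
    exact Submodule.neg_mem _ (Submodule.subset_span
      ⟨Sum.inr (Sum.inr (Sum.inr (Sum.inr (Sum.inl ⟨(j, i), h⟩)))), rfl⟩)

/-- The Heisenberg algebra, spanned by `ξ`, `R_i` and `S_i`. -/
def heisSpan (n : ℕ) : Submodule ℝ (Heis n → Heis n) :=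
  Submodule.span ℝ ({xiVF} ∪ Set.range Rf ∪ Set.range Sf)

theorem xiVF_mem_heisSpan : xiVF ∈ heisSpan n :=
  Submodule.subset_span (Or.inl (Or.inl rfl))

theorem Rf_mem_heisSpan (i : Fin n) : Rf i ∈ heisSpan n :=
  Submodule.subset_span (Or.inl (Or.inr ⟨i, rfl⟩))

theorem Sf_mem_heisSpan (i : Fin n) : Sf i ∈ heisSpan n :=
  Submodule.subset_span (Or.inr ⟨i, rfl⟩)

theorem heisGen_subset_range :
    ({xiVF} ∪ Set.range Rf ∪ Set.range Sf : Set (Heis n → Heis n)) ⊆ Set.range (crFam n) := by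
  rintro _ ((rfl | ⟨i, rfl⟩) | ⟨i, rfl⟩)
  · exact ⟨Sum.inl (), rfl⟩
  · exact ⟨Sum.inr (Sum.inl i), rfl⟩
  · exact ⟨Sum.inr (Sum.inr (Sum.inl i)), rfl⟩

theorem lieVF_crFam_xiVF_mem (a : CRIdx n) : lieVF (crFam n a) xiVF ∈ heisSpan n := by
  rcases a with _ | i | i | q | q | _ <;> simp only [crFam]
  · simp [lieVF_self]
  · simp [lieVF_Rf_xiVF]
  · simp [lieVF_Sf_xiVF]
  · simp [lieVF_Xf_xiVF]
  · simp [lieVF_Yf_xiVF]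
  · rw [lieVF_DilVF_xiVF]
    exact Submodule.smul_mem _ _ xiVF_mem_heisSpan

theorem lieVF_crFam_Rf_mem (a : CRIdx n) (k : Fin n) :
    lieVF (crFam n a) (Rf k) ∈ heisSpan n := by
  have hξ := xiVF_mem_heisSpan (n := n)
  have hR := Rf_mem_heisSpan (n := n)
  have hS := Sf_mem_heisSpan (n := n)
  rcases a with _ | i | i | q | q | _ <;> simp only [crFam]
  · rw [lieVF_swap, lieVF_Rf_xiVF]
    simp
  · simp [lieVF_Rf_Rf]
  · rw [lieVF_Sf_Rf]
    exact Submodule.neg_mem _ (Submodule.smul_mem _ _ hξ)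
  · rw [lieVF_Xf_Rf]
    exact Submodule.neg_mem _ (Submodule.add_mem _ (Submodule.smul_mem _ _ (hS _))
      (Submodule.smul_mem _ _ (hS _)))
  · rw [lieVF_Yf_Rf]
    exact Submodule.sub_mem _ (Submodule.smul_mem _ _ (hR _)) (Submodule.smul_mem _ _ (hR _))
  · rw [lieVF_DilVF_Rf]
    exact Submodule.neg_mem _ (hR k)

theorem lieVF_crFam_Sf_mem (a : CRIdx n) (k : Fin n) :
    lieVF (crFam n a) (Sf k) ∈ heisSpan n := by
  have hξ := xiVF_mem_heisSpan (n := n)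
  have hR := Rf_mem_heisSpan (n := n)
  have hS := Sf_mem_heisSpan (n := n)
  rcases a with _ | i | i | q | q | _ <;> simp only [crFam]
  · rw [lieVF_swap, lieVF_Sf_xiVF]
    simp
  · rw [lieVF_swap, lieVF_Sf_Rf, neg_neg]
    exact Submodule.smul_mem _ _ hξ
  · simp [lieVF_Sf_Sf]
  · rw [lieVF_Xf_Sf]
    exact Submodule.add_mem _ (Submodule.smul_mem _ _ (hR _)) (Submodule.smul_mem _ _ (hR _))
  · rw [lieVF_Yf_Sf]
    exact Submodule.sub_mem _ (Submodule.smul_mem _ _ (hS _)) (Submodule.smul_mem _ _ (hS _))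
  · rw [lieVF_DilVF_Sf]
    exact Submodule.neg_mem _ (hS k)

theorem lieVF_crFam_mem_heisSpan (a : CRIdx n) {B : Heis n → Heis n}
    (hB : B ∈ ({xiVF} ∪ Set.range Rf ∪ Set.range Sf : Set (Heis n → Heis n))) :
    lieVF (crFam n a) B ∈ heisSpan n := by
  rcases hB with (rfl | ⟨k, rfl⟩) | ⟨k, rfl⟩
  · exact lieVF_crFam_xiVF_mem a
  · exact lieVF_crFam_Rf_mem a k
  · exact lieVF_crFam_Sf_mem a k

theorem lieVF_Xf_Yf_mem (i j k l : Fin n) :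
    lieVF (Xf i j) (Yf k l) ∈ Submodule.span ℝ (Set.range (crFam n)) := by
  rw [lieVF_Xf_Yf]
  exact Submodule.sub_mem _ (Submodule.sub_mem _ (Submodule.add_mem _
    (Submodule.smul_mem _ _ (Xf_mem _ _)) (Submodule.smul_mem _ _ (Xf_mem _ _)))
    (Submodule.smul_mem _ _ (Xf_mem _ _))) (Submodule.smul_mem _ _ (Xf_mem _ _))

theorem lieVF_crFam_crFam_mem (a b : CRIdx n) :
    lieVF (crFam n a) (crFam n b) ∈ Submodule.span ℝ (Set.range (crFam n)) := by
  have hle : heisSpan n ≤ Submodule.span ℝ (Set.range (crFam n)) :=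
    Submodule.span_mono heisGen_subset_range
  have right (a : CRIdx n) {B : Heis n → Heis n}
      (hB : B ∈ ({xiVF} ∪ Set.range Rf ∪ Set.range Sf : Set (Heis n → Heis n))) :
      lieVF (crFam n a) B ∈ Submodule.span ℝ (Set.range (crFam n)) :=
    hle (lieVF_crFam_mem_heisSpan a hB)
  have left (b : CRIdx n) {A : Heis n → Heis n}
      (hA : A ∈ ({xiVF} ∪ Set.range Rf ∪ Set.range Sf : Set (Heis n → Heis n))) :
      lieVF A (crFam n b) ∈ Submodule.span ℝ (Set.range (crFam n)) := by
    rw [lieVF_swap]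
    exact Submodule.neg_mem _ (right b hA)
  rcases b with _ | k | k | r | r | _
  · exact right a (Or.inl (Or.inl rfl))
  · exact right a (Or.inl (Or.inr ⟨k, rfl⟩))
  · exact right a (Or.inr ⟨k, rfl⟩)
  all_goals
    rcases a with _ | i | i | q | q | _
    · exact left _ (Or.inl (Or.inl rfl))
    · exact left _ (Or.inl (Or.inr ⟨i, rfl⟩))
    · exact left _ (Or.inr ⟨i, rfl⟩)
    all_goals simp only [crFam]
  · rw [lieVF_Xf_Xf]
    exact Submodule.neg_mem _ (Submodule.add_mem _ (Submodule.add_mem _ (Submodule.add_mem _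
      (Submodule.smul_mem _ _ (Yf_mem _ _)) (Submodule.smul_mem _ _ (Yf_mem _ _)))
      (Submodule.smul_mem _ _ (Yf_mem _ _))) (Submodule.smul_mem _ _ (Yf_mem _ _)))
  · rw [lieVF_swap]
    exact Submodule.neg_mem _ (lieVF_Xf_Yf_mem _ _ _ _)
  · simp [lieVF_DilVF_Xf]
  · exact lieVF_Xf_Yf_mem _ _ _ _
  · rw [lieVF_Yf_Yf]
    exact Submodule.add_mem _ (Submodule.sub_mem _ (Submodule.sub_mem _
      (Submodule.smul_mem _ _ (Yf_mem _ _)) (Submodule.smul_mem _ _ (Yf_mem _ _)))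
      (Submodule.smul_mem _ _ (Yf_mem _ _))) (Submodule.smul_mem _ _ (Yf_mem _ _))
  · simp [lieVF_DilVF_Yf]
  · rw [lieVF_swap, lieVF_DilVF_Xf]
    simp
  · rw [lieVF_swap, lieVF_DilVF_Yf]
    simp
  · simp [lieVF_self]

/-- Evaluation of a vector field at a point, as a linear map. -/
def evalAt (p : Heis n) : (Heis n → Heis n) →ₗ[ℝ] Heis n := LinearMap.proj p

/-- The linear form `∂_{x_i} ↦ 1` on tangent vectors. -/
def dx (i : Fin n) : Heis n →ₗ[ℝ] ℝ := LinearMap.proj i ∘ₗ LinearMap.fst ℝ _ _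

/-- The linear form `∂_{y_i} ↦ 1` on tangent vectors. -/
def dy (i : Fin n) : Heis n →ₗ[ℝ] ℝ :=
  LinearMap.proj i ∘ₗ LinearMap.fst ℝ _ _ ∘ₗ LinearMap.snd ℝ _ _

/-- The linear form `∂_z ↦ 1` on tangent vectors. -/
def dz : Heis n →ₗ[ℝ] ℝ := LinearMap.snd ℝ _ _ ∘ₗ LinearMap.snd ℝ _ _

/-- Linear forms on vector fields that are dual, up to scaling, to the family `crFam n`. -/
def dualForm : CRIdx n → Module.Dual ℝ (Heis n → Heis n) := fun k =>
  match k with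
  | Sum.inl _ => dz ∘ₗ evalAt 0
  | Sum.inr (Sum.inl i) => dx i ∘ₗ evalAt 0
  | Sum.inr (Sum.inr (Sum.inl i)) => dy i ∘ₗ evalAt 0
  | Sum.inr (Sum.inr (Sum.inr (Sum.inl q))) =>
      dy q.1.2 ∘ₗ (evalAt (Pi.single q.1.1 1, 0, 0) - evalAt 0)
  | Sum.inr (Sum.inr (Sum.inr (Sum.inr (Sum.inl q)))) =>
      dx q.1.2 ∘ₗ (evalAt (Pi.single q.1.1 1, 0, 0) - evalAt 0)
  | Sum.inr (Sum.inr (Sum.inr (Sum.inr (Sum.inr _)))) => dz ∘ₗ (evalAt (0, 0, 1) - evalAt 0)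

theorem dualForm_crFam_self_ne_zero (a : CRIdx n) : dualForm a (crFam n a) ≠ 0 := by
  rcases a with _ | i | i | ⟨⟨i, j⟩, h⟩ | ⟨⟨i, j⟩, h⟩ | _ <;>
    simp [dualForm, crFam, dx, dy, dz, evalAt, xiVF, Rf, Sf, Xf, Yf, DilVF, Pi.single_apply]
  · split_ifs <;> norm_num
  · rw [if_neg (show ¬j = i from h.ne')]
    simp

theorem dualForm_crFam_eq_zero {a b : CRIdx n} (hab : a ≠ b) : dualForm a (crFam n b) = 0 := by
  rcases a with _ | i | i | ⟨⟨i, j⟩, h⟩ | ⟨⟨i, j⟩, h⟩ | _ <;>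
  rcases b with _ | k | k | ⟨⟨k, l⟩, h'⟩ | ⟨⟨k, l⟩, h'⟩ | _ <;>
    simp [dualForm, crFam, dx, dy, dz, evalAt, xiVF, Rf, Sf, Xf, Yf, DilVF, Pi.single_apply]
  · exact hab rfl
  · rintro rfl
    exact hab rfl
  · rintro rfl
    exact hab rfl
  · have hik : ¬(j = l ∧ k = i) := by
      rintro ⟨rfl, rfl⟩
      exact hab rfl
    have hjk : ¬(j = k ∧ l = i) := by
      rintro ⟨rfl, rfl⟩
      exact hik ⟨le_antisymm h' h, le_antisymm h' h⟩
    rw [← ite_and, ← ite_and, if_neg hik, if_neg hjk, add_zero]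
  · have hik : ¬(j = l ∧ k = i) := by
      rintro ⟨rfl, rfl⟩
      exact hab rfl
    have hjk : ¬(j = k ∧ l = i) := by
      rintro ⟨rfl, rfl⟩
      exact lt_asymm h h'
    rw [← ite_and, ← ite_and, if_neg hik, if_neg hjk, sub_zero]
  · exact h.ne'
  · exact hab rfl

theorem linearIndependent_crFam : LinearIndependent ℝ (crFam n) :=
  LinearIndependent.of_pairwise_dual_eq_zero_one _
    (fun a => (dualForm a (crFam n a))⁻¹ • dualForm a)
    (fun a b hab => by simp [dualForm_crFam_eq_zero hab])
    (fun a => by simp [dualForm_crFam_self_ne_zero a])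

instance : Fintype (CRIdx n) := by
  unfold CRIdx
  infer_instance

theorem card_le_add_card_lt :
    Fintype.card {q : Fin n × Fin n // q.1 ≤ q.2} +
      Fintype.card {q : Fin n × Fin n // q.1 < q.2} = n ^ 2 := by
  have e : {q : Fin n × Fin n // q.1 < q.2} ≃ {q : Fin n × Fin n // ¬ q.1 ≤ q.2} :=
    (Equiv.prodComm _ _).subtypeEquiv fun q => by simp
  rw [Fintype.card_congr e, Fintype.card_subtype_compl]
  have := Fintype.card_subtype_le (fun q : Fin n × Fin n => q.1 ≤ q.2)
  rw [Nat.add_sub_cancel' this]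
  simp [sq]

theorem card_CRIdx : Fintype.card (CRIdx n) = n ^ 2 + 2 * n + 2 := by
  have h : Fintype.card (CRIdx n) = 1 + (n + (n + (
      Fintype.card {q : Fin n × Fin n // q.1 ≤ q.2} +
      (Fintype.card {q : Fin n × Fin n // q.1 < q.2} + 1)))) := by
    rw [← Fintype.card_unit, ← Fintype.card_fin n]
    simp only [← Fintype.card_sum]
    rw [Fintype.card_fin n]
    exact Fintype.card_congr (Equiv.refl _)
  have := card_le_add_card_lt (n := n)
  omega

end Heis

/-- The span `g` of the vector fields `ξ, R_i, S_i, X_{ij} (i ≤ j), Y_{ij} (i < j), D`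
is closed under Lie bracket; the generators are linearly independent, so
`dim g = n² + 2n + 2`; and the span `h` of `{ξ, R_i, S_i}` is an ideal of `g`. -/
theorem stmt4 (n : ℕ) :
    (∀ A ∈ Submodule.span ℝ (Set.range (crFam n)),
      ∀ B ∈ Submodule.span ℝ (Set.range (crFam n)),
        lieVF A B ∈ Submodule.span ℝ (Set.range (crFam n))) ∧
    LinearIndependent ℝ (crFam n) ∧
    Module.finrank ℝ ↥(Submodule.span ℝ (Set.range (crFam n))) = n ^ 2 + 2 * n + 2 ∧
    (∀ A ∈ Submodule.span ℝ (Set.range (crFam n)),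
      ∀ B ∈ Submodule.span ℝ
          (({xiVF} ∪ Set.range Rf ∪ Set.range Sf : Set (Heis n → Heis n))),
        lieVF A B ∈ Submodule.span ℝ
          (({xiVF} ∪ Set.range Rf ∪ Set.range Sf : Set (Heis n → Heis n)))) := by
  have hg : ∀ V ∈ Set.range (crFam n), Differentiable ℝ V := by
    rintro _ ⟨k, rfl⟩
    exact Heis.differentiable_crFam k
  refine ⟨fun A hA B hB => ?_, Heis.linearIndependent_crFam, ?_, fun A hA B hB => ?_⟩
  · refine Heis.lieVF_mem_of_mem_span hg hg ?_ hA hB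
    rintro _ ⟨a, rfl⟩ _ ⟨b, rfl⟩
    exact Heis.lieVF_crFam_crFam_mem a b
  · rw [finrank_span_eq_card Heis.linearIndependent_crFam, Heis.card_CRIdx]
  · refine Heis.lieVF_mem_of_mem_span hg (fun V hV => hg V (Heis.heisGen_subset_range hV)) ?_ hA hB
    rintro _ ⟨a, rfl⟩ W hW
    exact Heis.lieVF_crFam_mem_heisSpan a hW
end

section
/- For all a ∈ ℝ, b = (b_1,…,b_n) ∈ ℝ^n and every point p = (x,y,z) ∈ ℝ^{2n+1}, one has η^R_p((aξ + Σ_i b_i X_{ii})(p)) = a + Σ_i b_i(x_i² + y_i²); consequently the function p ↦ η^R_p((aξ + Σ_i b_i X_{ii})(p)) is strictly positive on all of ℝ^{2n+1} if and only if a > 0 and b_i ≥ 0 for every i. (This positivity condition determines the unreduced Sasaki cone of the standard CR structure on ℍ^{2n+1}, which has dimension n+1.) -/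
/-- `X_{ii} = 2x_i∂_{y_i} − 2y_i∂_{x_i} + (x_i² − y_i²)∂_z`. -/
def Xii {n : ℕ} (i : Fin n) : Heis n → Heis n := fun p =>
  (fun k => -2 * p.2.1 i * (if k = i then 1 else 0),
   fun k => 2 * p.1 i * (if k = i then 1 else 0),
   (p.1 i) ^ 2 - (p.2.1 i) ^ 2)

theorem etaR_smul_xiVF_add_sum_smul_Xii {n : ℕ} (a : ℝ) (b : Fin n → ℝ) (p : Heis n) :
    etaR p ((a • xiVF + ∑ i, b i • Xii i : Heis n → Heis n) p) =
      a + ∑ i, b i * ((p.1 i) ^ 2 + (p.2.1 i) ^ 2) := by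
  simp only [etaR, xiVF, Xii, Pi.add_apply, Pi.smul_apply, Finset.sum_apply, Prod.fst_add,
    Prod.snd_add, Prod.smul_fst, Prod.smul_snd, Prod.fst_sum, Prod.snd_sum, smul_eq_mul,
    Pi.zero_apply, mul_zero, zero_add, mul_one, mul_ite, Finset.sum_ite_eq, Finset.mem_univ,
    if_true]
  rw [add_sub_assoc, ← Finset.sum_sub_distrib]
  congr 1
  exact Finset.sum_congr rfl fun i _ => by ring

theorem forall_pos_add_sum_mul_sq_iff {n : ℕ} (a : ℝ) (b : Fin n → ℝ) :
    (∀ p : Heis n, 0 < a + ∑ i, b i * ((p.1 i) ^ 2 + (p.2.1 i) ^ 2)) ↔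
      0 < a ∧ ∀ i, 0 ≤ b i := by
  constructor
  · intro h
    have ha : 0 < a := by simpa using h 0
    refine ⟨ha, fun i => ?_⟩
    by_contra! hi
    have hs := h (Pi.single i √(a / -b i), 0, 0)
    have hsq : √(a / -b i) ^ 2 = a / -b i :=
      Real.sq_sqrt (div_nonneg ha.le (neg_nonneg.2 hi.le))
    simp only [Pi.single_apply, ite_pow, hsq, Pi.zero_apply, ne_eq, OfNat.ofNat_ne_zero,
      not_false_eq_true, zero_pow, add_zero, mul_ite, mul_zero, Finset.sum_ite_eq',
      Finset.mem_univ, if_true] at hs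
    have hmul : b i * (a / -b i) = -a := by field_simp [hi.ne]
    linarith
  · rintro ⟨ha, hb⟩ p
    exact add_pos_of_pos_of_nonneg ha
      (Finset.sum_nonneg fun i _ => mul_nonneg (hb i) (by positivity))

/-- `η^R_p((aξ + Σ_i b_i X_{ii})(p)) = a + Σ_i b_i(x_i² + y_i²)`, which is strictly
positive everywhere iff `a > 0` and `b_i ≥ 0` for all `i`: the positivity condition
cutting out the unreduced Sasaki cone of the standard CR structure on `ℍ^{2n+1}`. -/
theorem stmt12 (n : ℕ) (a : ℝ) (b : Fin n → ℝ) :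
    (∀ p : Heis n,
      etaR p (((a • xiVF + ∑ i, b i • Xii i : Heis n → Heis n) p)) =
        a + ∑ i, b i * ((p.1 i) ^ 2 + (p.2.1 i) ^ 2)) ∧
    ((∀ p : Heis n, 0 < etaR p (((a • xiVF + ∑ i, b i • Xii i : Heis n → Heis n) p))) ↔
      (0 < a ∧ ∀ i, 0 ≤ b i)) := by
  simp only [etaR_smul_xiVF_add_sum_smul_Xii]
  exact ⟨fun _ => trivial, forall_pos_add_sum_mul_sq_iff a b⟩
end

section
/- For every a = (a_1,…,a_n) ∈ ℝ^n with a_i ≥ 0 for all i, the ℝ-action generated by the Reeb vector field ξ_a is free: if φ : ℝ × ℝ^{2n+1} → ℝ^{2n+1} is the flow of ξ_a (i.e. φ(0,p) = p and ∂φ/∂t(t,p) = ξ_a(φ(t,p)) for all t, p) and φ(t,p) = p for some point p and some t ∈ ℝ, then t = 0. -/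
/-- The Reeb vector field `ξ_a`: its value at `(x,y,z)` has `x_i`-component `−4a_i y_i`,
`y_i`-component `4a_i x_i`, and `z`-component `1 + 2Σ_i a_i(x_i² − y_i²)`. -/
def xiA {n : ℕ} (a : Fin n → ℝ) : Heis n → Heis n := fun p =>
  (fun i => -4 * a i * p.2.1 i,
   fun i => 4 * a i * p.1 i,
   1 + 2 * ∑ i, a i * ((p.1 i) ^ 2 - (p.2.1 i) ^ 2))

/-- Along an integral curve of `ξ_a` the function `z - (1/2) Σ_i x_i y_i` grows at unit speed. -/
theorem hasDerivAt_height_of_hasDerivAt_xiA {n : ℕ} {a : Fin n → ℝ} {γ : ℝ → Heis n} {t : ℝ}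
    (hγ : HasDerivAt γ (xiA a (γ t)) t) :
    HasDerivAt (fun s => (γ s).2.2 - 1 / 2 * ∑ i, (γ s).1 i * (γ s).2.1 i) 1 t := by
  have hx : HasDerivAt (fun s => (γ s).1) (xiA a (γ t)).1 t :=
    (ContinuousLinearMap.fst ℝ (Fin n → ℝ) ((Fin n → ℝ) × ℝ)).hasFDerivAt.comp_hasDerivAt t hγ
  have hyz : HasDerivAt (fun s => (γ s).2) (xiA a (γ t)).2 t :=
    (ContinuousLinearMap.snd ℝ (Fin n → ℝ) ((Fin n → ℝ) × ℝ)).hasFDerivAt.comp_hasDerivAt t hγ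
  have hy : HasDerivAt (fun s => (γ s).2.1) (xiA a (γ t)).2.1 t :=
    (ContinuousLinearMap.fst ℝ (Fin n → ℝ) ℝ).hasFDerivAt.comp_hasDerivAt t hyz
  have hz : HasDerivAt (fun s => (γ s).2.2) (xiA a (γ t)).2.2 t :=
    (ContinuousLinearMap.snd ℝ (Fin n → ℝ) ℝ).hasFDerivAt.comp_hasDerivAt t hyz
  have hsum := HasDerivAt.fun_sum (u := Finset.univ) fun i _ =>
    (hasDerivAt_pi.1 hx i).fun_mul (hasDerivAt_pi.1 hy i)
  refine (hz.fun_sub (hsum.const_mul (1 / 2))).congr_deriv ?_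
  simp only [xiA, Finset.mul_sum]
  rw [add_sub_assoc, ← Finset.sum_sub_distrib, Finset.sum_eq_zero fun i _ => by ring, add_zero]

/-- For `a_i ≥ 0` the `ℝ`-action generated by the Reeb vector field `ξ_a` is free:
if the flow returns a point to itself at time `t`, then `t = 0`. -/
theorem stmt15 (n : ℕ) (a : Fin n → ℝ) (ha : ∀ i, 0 ≤ a i)
    (φ : ℝ → Heis n → Heis n)
    (hφ0 : ∀ p : Heis n, φ 0 p = p)
    (hφ' : ∀ (t : ℝ) (p : Heis n), HasDerivAt (fun s => φ s p) (xiA a (φ t p)) t) :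
    ∀ (t : ℝ) (p : Heis n), φ t p = p → t = 0 := by
  intro t p hp
  have hder (s : ℝ) : HasDerivAt
      (fun s => (φ s p).2.2 - 1 / 2 * ∑ i, (φ s p).1 i * (φ s p).2.1 i - s) 0 s := by
    simpa using (hasDerivAt_height_of_hasDerivAt_xiA (hφ' s p)).fun_sub (hasDerivAt_id' s)
  have hconst := is_const_of_deriv_eq_zero (fun s => (hder s).differentiableAt)
    (fun s => (hder s).deriv) t 0
  simp only [hp, hφ0] at hconst
  linarith
end

section
/- For every a = (a_1,…,a_n) ∈ ℝ^n with a_i ≥ 0 for all i, the ℝ-action generated by the Reeb vector field ξ_a is proper: if φ : ℝ × ℝ^{2n+1} → ℝ^{2n+1} is the flow of ξ_a (i.e. φ(0,p) = p and ∂φ/∂t(t,p) = ξ_a(φ(t,p)) for all t, p), then the map ℝ × ℝ^{2n+1} → ℝ^{2n+1} × ℝ^{2n+1}, (t,p) ↦ (p, φ(t,p)), is a proper map (the preimage of every compact set is compact). -/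
theorem eq_of_hasDerivAt_zero {f : ℝ → ℝ} (hf : ∀ t, HasDerivAt f 0 t) (t : ℝ) : f t = f 0 :=
  is_const_of_deriv_eq_zero (fun s => (hf s).differentiableAt) (fun s => (hf s).deriv) t 0

/-- Solutions of the planar system `u' = -c v`, `v' = c u` are rotations. -/
theorem rotation_of_hasDerivAt {c : ℝ} {u v : ℝ → ℝ}
    (hu : ∀ t, HasDerivAt u (-c * v t) t) (hv : ∀ t, HasDerivAt v (c * u t) t) (t : ℝ) :
    u t = u 0 * Real.cos (c * t) - v 0 * Real.sin (c * t) ∧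
      v t = u 0 * Real.sin (c * t) + v 0 * Real.cos (c * t) := by
  have hct : ∀ s : ℝ, HasDerivAt (fun s => c * s) c s := fun s => by
    simpa using (hasDerivAt_id s).const_mul c
  have h₁ := eq_of_hasDerivAt_zero
    (f := fun s => u s * Real.cos (c * s) + v s * Real.sin (c * s)) (fun s => by
      refine (((hu s).mul (hct s).cos).add ((hv s).mul (hct s).sin)).congr_deriv ?_
      ring) t
  have h₂ := eq_of_hasDerivAt_zero
    (f := fun s => v s * Real.cos (c * s) - u s * Real.sin (c * s)) (fun s => by
      refine (((hv s).mul (hct s).cos).sub ((hu s).mul (hct s).sin)).congr_deriv ?_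
      ring) t
  simp only [mul_zero, Real.cos_zero, Real.sin_zero, mul_one, add_zero, sub_zero] at h₁ h₂
  have hsc := Real.sin_sq_add_cos_sq (c * t)
  rw [← h₁, ← h₂]
  constructor
  · linear_combination (-u t) * hsc
  · linear_combination (-v t) * hsc

namespace Heis

variable {n : ℕ}

/-- The function `z - ½ Σ x_i y_i`, which increases at unit speed along every `ξ_a`. -/
noncomputable def clock (p : Heis n) : ℝ := p.2.2 - (∑ i, p.1 i * p.2.1 i) / 2

theorem continuous_clock : Continuous (clock : Heis n → ℝ) := by
  unfold clock
  fun_prop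

variable {a : Fin n → ℝ} {γ : ℝ → Heis n}

theorem hasDerivAt_x (hγ : ∀ t, HasDerivAt γ (xiA a (γ t)) t) (i : Fin n) (t : ℝ) :
    HasDerivAt (fun s => (γ s).1 i) (-(4 * a i) * (γ t).2.1 i) t :=
  (hasDerivAt_pi.1 (hγ t).fst i).congr_deriv (by simp [xiA])

theorem hasDerivAt_y (hγ : ∀ t, HasDerivAt γ (xiA a (γ t)) t) (i : Fin n) (t : ℝ) :
    HasDerivAt (fun s => (γ s).2.1 i) (4 * a i * (γ t).1 i) t :=
  hasDerivAt_pi.1 (hγ t).snd.fst i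

theorem clock_eq_add (hγ : ∀ t, HasDerivAt γ (xiA a (γ t)) t) (t : ℝ) :
    clock (γ t) = clock (γ 0) + t := by
  have h := eq_of_hasDerivAt_zero (f := fun s => clock (γ s) - s) (fun s => by
    have hz : HasDerivAt (fun s => (γ s).2.2) _ s := (hγ s).snd.snd
    have hxy := HasDerivAt.fun_sum (u := Finset.univ)
      (fun i _ => (hasDerivAt_x hγ i s).mul (hasDerivAt_y hγ i s))
    refine ((hz.sub (hxy.div_const 2)).sub (hasDerivAt_id s)).congr_deriv ?_
    have hsum : ∑ i, (-(4 * a i) * (γ s).2.1 i * (γ s).2.1 i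
        + (γ s).1 i * (4 * a i * (γ s).1 i))
        = 4 * ∑ i, a i * ((γ s).1 i ^ 2 - (γ s).2.1 i ^ 2) := by
      rw [Finset.mul_sum]
      exact Finset.sum_congr rfl fun i _ => by ring
    rw [hsum]
    simp only [xiA]
    ring) t
  simp only [sub_zero] at h
  linarith

theorem continuous_flow {φ : ℝ → Heis n → Heis n} (hφ0 : ∀ p, φ 0 p = p)
    (hφ' : ∀ t p, HasDerivAt (fun s => φ s p) (xiA a (φ t p)) t) :
    Continuous fun q : ℝ × Heis n => φ q.1 q.2 := by
  have hrot := fun (q : ℝ × Heis n) (i : Fin n) => rotation_of_hasDerivAt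
    (hasDerivAt_x (hφ' · q.2) i) (hasDerivAt_y (hφ' · q.2) i) q.1
  simp only [hφ0] at hrot
  have hx : Continuous fun q : ℝ × Heis n => (φ q.1 q.2).1 := by
    refine continuous_pi fun i => ?_
    simp only [fun q => (hrot q i).1]
    fun_prop
  have hy : Continuous fun q : ℝ × Heis n => (φ q.1 q.2).2.1 := by
    refine continuous_pi fun i => ?_
    simp only [fun q => (hrot q i).2]
    fun_prop
  have hz : ∀ q : ℝ × Heis n, (φ q.1 q.2).2.2
      = clock q.2 + q.1 + (∑ i, (φ q.1 q.2).1 i * (φ q.1 q.2).2.1 i) / 2 := fun q => by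
    have h := clock_eq_add (hφ' · q.2) q.1
    rw [hφ0] at h
    rw [← h, clock, sub_add_cancel]
  refine hx.prodMk (hy.prodMk ?_)
  simp only [hz]
  have := continuous_clock (n := n)
  fun_prop

end Heis

/-- For `a_i ≥ 0` the `ℝ`-action generated by the Reeb vector field `ξ_a` is proper:
the map `(t,p) ↦ (p, φ(t,p))` is a proper map. -/
theorem stmt16 (n : ℕ) (a : Fin n → ℝ) (ha : ∀ i, 0 ≤ a i)
    (φ : ℝ → Heis n → Heis n)
    (hφ0 : ∀ p : Heis n, φ 0 p = p)
    (hφ' : ∀ (t : ℝ) (p : Heis n), HasDerivAt (fun s => φ s p) (xiA a (φ t p)) t) :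
    IsProperMap (fun q : ℝ × Heis n => (q.2, φ q.1 q.2)) := by
  have hleft : Function.LeftInverse
      (fun r : Heis n × Heis n => (Heis.clock r.2 - Heis.clock r.1, r.1))
      (fun q : ℝ × Heis n => (q.2, φ q.1 q.2)) := fun q => by
    have h := Heis.clock_eq_add (hφ' · q.2) q.1
    rw [hφ0] at h
    exact Prod.ext (by simp [h]) rfl
  have := Heis.continuous_clock (n := n)
  exact (hleft.isClosedEmbedding (by fun_prop)
    (continuous_snd.prodMk (Heis.continuous_flow hφ0 hφ'))).isProperMap
end

section
/- Fix n ≥ 1 and a = (a_1,…,a_n) ∈ ℝ^n with a_i ≥ 0 for all i, and define s_a : ℂ^n → ℝ by s_a(z) = −n(2n+7)·(Σ_j a_j²|z_j|²)/(1 + Σ_j a_j|z_j|²) + 2n(4Σ_j a_j − 1). Then s_a is a constant function if and only if a = (0,…,0), in which case s_a is identically −2n. -/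
/-- The scalar curvature of the Sasakian metric `g_a` of the Sasakian structure `S_{1,a}`
in the Sasaki cone of the standard CR structure on `ℍ^{2n+1}`, as a function on the
transverse space `ℂ^n`:
`s_a(z) = −n(2n+7) (Σ_j a_j²|z_j|²)/(1 + Σ_j a_j|z_j|²) + 2n(4Σ_j a_j − 1)`. -/
noncomputable def scalA (n : ℕ) (a : Fin n → ℝ) (z : Fin n → ℂ) : ℝ :=
  -(n * (2 * n + 7)) * (∑ j, (a j) ^ 2 * ‖z j‖ ^ 2) / (1 + ∑ j, a j * ‖z j‖ ^ 2) +
    2 * n * (4 * (∑ j, a j) - 1)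

theorem scalA_zero_left (n : ℕ) (z : Fin n → ℂ) : scalA n 0 z = -(2 * n) := by
  simp [scalA]

theorem scalA_zero_right (n : ℕ) (a : Fin n → ℝ) :
    scalA n a 0 = 2 * n * (4 * (∑ j, a j) - 1) := by
  simp [scalA]

theorem scalA_single (n : ℕ) (a : Fin n → ℝ) (i : Fin n) :
    scalA n a (Pi.single i 1) =
      -(n * (2 * n + 7)) * (a i) ^ 2 / (1 + a i) + 2 * n * (4 * (∑ j, a j) - 1) := by
  have sum_single (b : Fin n → ℝ) :
      ∑ j, b j * ‖(Pi.single i 1 : Fin n → ℂ) j‖ ^ 2 = b i := by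
    rw [Finset.sum_eq_single i]
    · simp
    · intro j _ hj
      simp [Pi.single_eq_of_ne hj]
    · simp
  rw [scalA, sum_single a, sum_single fun j => a j ^ 2]

/-- The scalar curvature `s_a` is constant iff `a = 0`, in which case it is identically
`−2n`: the standard Sasakian structure is the only one in the Sasaki cone with constant
scalar curvature. -/
theorem stmt17 (n : ℕ) (hn : 1 ≤ n) (a : Fin n → ℝ) (ha : ∀ i, 0 ≤ a i) :
    ((∃ c : ℝ, ∀ z : Fin n → ℂ, scalA n a z = c) ↔ a = 0) ∧
    (a = 0 → ∀ z : Fin n → ℂ, scalA n a z = -(2 * n)) := by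
  refine ⟨⟨?_, ?_⟩, ?_⟩
  · rintro ⟨c, hc⟩
    funext i
    have h := (hc (Pi.single i 1)).trans (hc 0).symm
    rw [scalA_single, scalA_zero_right, add_eq_right, div_eq_zero_iff] at h
    have hpos : 0 < 1 + a i := by linarith [ha i]
    have hn' : (0 : ℝ) < n := by exact_mod_cast hn
    have hcoef : -((n : ℝ) * (2 * n + 7)) ≠ 0 := neg_ne_zero.mpr (by positivity)
    exact pow_eq_zero_iff two_ne_zero |>.mp <|
      (mul_eq_zero.mp (h.resolve_right hpos.ne')).resolve_left hcoef
  · rintro rfl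
    exact ⟨_, scalA_zero_left n⟩
  · rintro rfl
    exact scalA_zero_left n
end
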